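/- For the trivial bundle ℝ^{n+p} → ℝ^n with coordinates (x^λ, y^i) and jet coordinates y^i_Λ, the horizontal differential d_H = dx^λ ∧ d_λ, where d_λ = ∂_λ + Σ_Λ y^i_{λ+Λ} ∂_i^Λ, is exact on horizontal forms of degree 0 < m < n that are smooth functions of finitely many jet coordinates: every d_H-closed horizontal m-form φ with 0 < m < n is d_H-exact, φ = d_H ξ for some horizontal (m−1)-form ξ depending on finitely many jet variables (algebraic Poincaré lemma). -/

import Mathlib

noncomputable section
attribute [local instance] Classical.propDecidable

/-- A point of the infinite jet space `J^∞` of the trivial bundle `ℝ^{n+p} → ℝ^n`: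
base coordinates `x^λ` (`λ : Fin n`) and jet coordinates `y^i_Λ` for multi-indices
`Λ : Fin n → ℕ`. -/
abbrev Jet (n p : ℕ) := (Fin n → ℝ) × (Fin p → (Fin n → ℕ) → ℝ)

/-- The finite-dimensional truncation of `J^∞` keeping only the jet coordinates `y^i_Λ`
with all entries of `Λ` at most `r` (which contains all `|Λ| ≤ r`). -/
abbrev JTrunc (n p r : ℕ) := (Fin n → ℝ) × (Fin p → (Fin n → Fin (r + 1)) → ℝ)

/-- The truncation map `J^∞ → J^r`. -/
def trunc (n p r : ℕ) : Jet n p → JTrunc n p r :=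
  fun z => (z.1, fun i Λ => z.2 i fun μ => (Λ μ : ℕ))

/-- A function on `J^∞` that is a smooth function of `x` and of finitely many jet
coordinates: it factors through some finite truncation via a `C^∞` function. -/
def SmoothOfOrder {n p : ℕ} (r : ℕ) (φ : Jet n p → ℝ) : Prop :=
  ∃ F : JTrunc n p r → ℝ, ContDiff ℝ (⊤ : ℕ∞) F ∧ φ = F ∘ trunc n p r

def FiniteOrderSmooth {n p : ℕ} (φ : Jet n p → ℝ) : Prop := ∃ r, SmoothOfOrder r φ

/-- The coordinate direction `∂/∂x^λ` in a truncated jet space. -/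
def xdir {n p r : ℕ} (lam : Fin n) : JTrunc n p r := (Pi.single lam 1, 0)

/-- The coordinate direction `∂/∂y^i_Λ` in a truncated jet space. -/
def ydir {n p r : ℕ} (i : Fin p) (Λ : Fin n → Fin (r + 1)) : JTrunc n p r :=
  (0, Pi.single i (Pi.single Λ 1))

/-- The multi-index `Λ + e_λ`. -/
def addIdx {n r : ℕ} (Λ : Fin n → Fin (r + 1)) (lam : Fin n) : Fin n → ℕ :=
  fun μ => (Λ μ : ℕ) + if μ = lam then 1 else 0

/-- The total derivative `d_λ = ∂_λ + Σ_{i,Λ} y^i_{Λ+e_λ} ∂/∂y^i_Λ` of a function of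
finite jet order (defined via any smooth factorization through a finite truncation;
the value does not depend on the choice). -/
def totalDeriv {n p : ℕ} (lam : Fin n) (φ : Jet n p → ℝ) : Jet n p → ℝ :=
  if h : FiniteOrderSmooth φ then
    let r := h.choose
    let F := h.choose_spec.choose
    fun z =>
      fderiv ℝ F (trunc n p r z) (xdir lam) +
        ∑ i : Fin p, ∑ Λ : Fin n → Fin (r + 1),
          z.2 i (addIdx Λ lam) * fderiv ℝ F (trunc n p r z) (ydir i Λ)
  else 0

/-- The horizontal differential of a horizontal `m`-form with coefficients
`c_{λ₁⋯λ_m}`: `(d_H c)_{λ₀⋯λ_m} = Σ_j (-1)^j d_{λ_j} c_{λ₀⋯λ̂_j⋯λ_m}`. -/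
def dHform {n p m : ℕ} (c : (Fin m → Fin n) → Jet n p → ℝ) :
    (Fin (m + 1) → Fin n) → Jet n p → ℝ :=
  fun w => ∑ j : Fin (m + 1), ((-1 : ℝ) ^ (j : ℕ)) • totalDeriv (w j) (c (w ∘ j.succAbove))

/-- Antisymmetry of the coefficients of a horizontal form. -/
def Antisym {n p m : ℕ} (c : (Fin m → Fin n) → Jet n p → ℝ) : Prop :=
  ∀ (v : Fin m → Fin n) (σ : Equiv.Perm (Fin m)),
    c (v ∘ σ) = ((Equiv.Perm.sign σ : ℤ) : ℝ) • c v

section ParametricIntegral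

variable {E F : Type} [NormedAddCommGroup E] [NormedSpace ℝ E] [NormedAddCommGroup F]
  [NormedSpace ℝ F]

theorem hasFDerivAt_intervalIntegral_of_contDiff [ProperSpace E] {G : ℝ × E → F}
    (hG : ContDiff ℝ 1 G) (w : E) :
    HasFDerivAt (fun w => ∫ t in (0 : ℝ)..1, G (t, w))
      (∫ t in (0 : ℝ)..1, (fderiv ℝ G (t, w)).comp (ContinuousLinearMap.inr ℝ ℝ E)) w := by
  have hcont : Continuous fun q : ℝ × E =>
      (fderiv ℝ G q).comp (ContinuousLinearMap.inr ℝ ℝ E) :=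
    (hG.continuous_fderiv one_ne_zero).clm_comp continuous_const
  obtain ⟨C, hC⟩ := ((isCompact_Icc (a := (0 : ℝ)) (b := 1)).prod
    (isCompact_closedBall w 1)).exists_bound_of_continuousOn hcont.continuousOn
  refine intervalIntegral.hasFDerivAt_integral_of_dominated_of_fderiv_le
    (F := fun w t => G (t, w))
    (F' := fun w t => (fderiv ℝ G (t, w)).comp (ContinuousLinearMap.inr ℝ ℝ E))
    (bound := fun _ => C) (s := Metric.ball w 1) (Metric.ball_mem_nhds w one_pos) ?_ ?_ ?_ ?_ ?_ ?_
  · refine Filter.Eventually.of_forall fun v => Continuous.aestronglyMeasurable ?_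
    exact hG.continuous.comp (by fun_prop)
  · exact (hG.continuous.comp (by fun_prop : Continuous fun t : ℝ => (t, w))).intervalIntegrable _ _
  · exact (hcont.comp (by fun_prop : Continuous fun t : ℝ => (t, w))).aestronglyMeasurable
  · refine Filter.Eventually.of_forall fun t ht v hv =>
      hC (t, v) ⟨?_, Metric.ball_subset_closedBall hv⟩
    rw [Set.uIoc_of_le zero_le_one] at ht
    exact ⟨ht.1.le, ht.2⟩
  · exact intervalIntegrable_const
  · refine Filter.Eventually.of_forall fun t _ v _ => ?_
    have h1 : HasFDerivAt (fun v : E => (t, v)) (ContinuousLinearMap.inr ℝ ℝ E) v :=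
      hasFDerivAt_prodMk_right t v
    exact ((hG.differentiable one_ne_zero (t, v)).hasFDerivAt).comp v h1

theorem contDiff_fderiv_comp_inr {G : ℝ × E → F} (hG : ContDiff ℝ (⊤ : ℕ∞) G) :
    ContDiff ℝ (⊤ : ℕ∞) fun q => (fderiv ℝ G q).comp (ContinuousLinearMap.inr ℝ ℝ E) :=
  (hG.fderiv_right (m := (⊤ : ℕ∞)) (by simp)).clm_comp contDiff_const

end ParametricIntegral

theorem contDiff_intervalIntegral {E : Type} [NormedAddCommGroup E] [NormedSpace ℝ E]
    [ProperSpace E] (k : ℕ) : ∀ {F : Type} [NormedAddCommGroup F] [NormedSpace ℝ F]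
    [CompleteSpace F] {G : ℝ × E → F}, ContDiff ℝ (⊤ : ℕ∞) G →
      ContDiff ℝ k (fun w => ∫ t in (0 : ℝ)..1, G (t, w)) := by
  induction k with
  | zero =>
    intro F _ _ _ G hG
    have h1 : ContDiff ℝ 1 G := hG.of_le (by exact_mod_cast le_top)
    refine contDiff_zero.2 (continuous_iff_continuousAt.2 fun w => ?_)
    exact (hasFDerivAt_intervalIntegral_of_contDiff h1 w).continuousAt
  | succ k ih =>
    intro F _ _ _ G hG
    have h1 : ContDiff ℝ 1 G := hG.of_le (by exact_mod_cast le_top)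
    have hd := hasFDerivAt_intervalIntegral_of_contDiff h1
    refine (contDiff_succ_iff_fderiv (n := (k : WithTop ℕ∞))).2
      ⟨fun w => (hd w).differentiableAt, by simp, ?_⟩
    rw [show fderiv ℝ (fun w => ∫ t in (0 : ℝ)..1, G (t, w)) = _ from funext fun w => (hd w).fderiv]
    exact ih (contDiff_fderiv_comp_inr hG)

theorem contDiff_top_intervalIntegral {E F : Type} [NormedAddCommGroup E] [NormedSpace ℝ E]
    [ProperSpace E] [NormedAddCommGroup F] [NormedSpace ℝ F] [CompleteSpace F] {G : ℝ × E → F}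
    (hG : ContDiff ℝ (⊤ : ℕ∞) G) :
    ContDiff ℝ (⊤ : ℕ∞) (fun w => ∫ t in (0 : ℝ)..1, G (t, w)) :=
  contDiff_infty.2 fun k => contDiff_intervalIntegral k hG

section Koszul

variable {ι V : Type*} [AddCommGroup V] [Module ℝ V]

/-- Antisymmetry of a family of coefficients with values in a real vector space. -/
def IsAntisym {m : ℕ} (c : (Fin m → ι) → V) : Prop :=
  ∀ (v : Fin m → ι) (σ : Equiv.Perm (Fin m)), c (v ∘ σ) = ((Equiv.Perm.sign σ : ℤ) : ℝ) • c v

/-- The Koszul-type differential of a family of operators `D`. -/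
def koszulD (D : ι → V →ₗ[ℝ] V) {m : ℕ} (c : (Fin m → ι) → V) (w : Fin (m + 1) → ι) : V :=
  ∑ j : Fin (m + 1), ((-1 : ℝ) ^ (j : ℕ)) • D (w j) (c (w ∘ j.succAbove))

/-- The contraction `∑ μ, e_μ ι_μ`, homotopy operator of the Koszul-type differential. -/
def koszulH [Fintype ι] (e : ι → V →ₗ[ℝ] V) {m : ℕ} (c : (Fin (m + 1) → ι) → V)
    (v : Fin m → ι) : V :=
  ∑ μ, e μ (c (Fin.cons μ v : Fin (m + 1) → ι))

theorem koszulD_add_smul (D : ι → V →ₗ[ℝ] V) {m : ℕ} (a b : ℝ) (c c' : (Fin m → ι) → V) :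
    koszulD D (fun v => a • c v + b • c' v) =
      fun w => a • koszulD D c w + b • koszulD D c' w := by
  funext w
  simp only [koszulD, map_add, map_smul, Finset.smul_sum, smul_add, Finset.sum_add_distrib,
    smul_comm _ a, smul_comm _ b]

theorem IsAntisym.add_smul {m : ℕ} {c c' : (Fin m → ι) → V} (hc : IsAntisym c)
    (hc' : IsAntisym c') (a b : ℝ) : IsAntisym (fun v => a • c v + b • c' v) := by
  intro v σ
  simp only [hc v σ, hc' v σ, smul_add, smul_comm a, smul_comm b]

theorem IsAntisym.map {W : Type*} [AddCommGroup W] [Module ℝ W] {m : ℕ} {c : (Fin m → ι) → V}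
    (hc : IsAntisym c) (L : V →ₗ[ℝ] W) : IsAntisym (fun v => L (c v)) := by
  intro v σ
  simp only [hc v σ, map_smul]

theorem IsAntisym.koszulH [Fintype ι] (e : ι → V →ₗ[ℝ] V) {m : ℕ} {c : (Fin (m + 1) → ι) → V}
    (hc : IsAntisym c) : IsAntisym (koszulH e c) := by
  intro v σ
  have key (μ : ι) : (Fin.cons μ (v ∘ σ) : Fin (m + 1) → ι) =
      (Fin.cons μ v : Fin (m + 1) → ι) ∘ (Equiv.Perm.decomposeFin.symm (0, σ)) := by
    funext i
    refine Fin.cases ?_ (fun i => ?_) i <;> simp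
  simp only [_root_.koszulH, key, hc _ (Equiv.Perm.decomposeFin.symm (0, σ)),
    Equiv.Perm.decomposeFin.symm_sign, map_smul, Finset.smul_sum]
  simp

theorem IsAntisym.apply_cons_succAbove {m : ℕ} {c : (Fin (m + 1) → ι) → V} (hc : IsAntisym c)
    (w : Fin (m + 1) → ι) (i : Fin (m + 1)) :
    c (Fin.cons (w i) (w ∘ i.succAbove)) = ((-1 : ℝ) ^ (i : ℕ)) • c w := by
  have key : (Fin.cons (w i) (w ∘ i.succAbove) : Fin (m + 1) → ι) = w ∘ i.cycleRange.symm := by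
    funext j
    refine Fin.cases ?_ (fun j => ?_) j <;> simp
  rw [key, hc, Equiv.Perm.sign_symm, Fin.sign_cycleRange]
  simp

/-- The Cartan formula: if `[e_μ, D_λ] = ε δ_{μλ}` then
`D h + h D = ∑ μ, e_μ D_μ - ε (m + 1)` on antisymmetric families of degree `m + 1`. -/
theorem koszulD_koszulH_add [Fintype ι] [DecidableEq ι] (D e : ι → V →ₗ[ℝ] V) (ε : ℝ)
    (hcomm : ∀ μ l x, e μ (D l x) = D l (e μ x) + if μ = l then ε • x else 0)
    {m : ℕ} {c : (Fin (m + 1) → ι) → V} (hc : IsAntisym c) (w : Fin (m + 1) → ι) :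
    koszulD D (koszulH e c) w + koszulH e (koszulD D c) w =
      ∑ μ, e μ (D μ (c w)) - (ε * (m + 1)) • c w := by
  have h2 : koszulH e (koszulD D c) w = ∑ μ, e μ (D μ (c w)) -
      ∑ i : Fin (m + 1), ((-1 : ℝ) ^ (i : ℕ)) • ∑ μ,
        (D (w i) (e μ (c (Fin.cons μ (w ∘ i.succAbove))))
        + if μ = w i then ε • c (Fin.cons μ (w ∘ i.succAbove)) else 0) := by
    simp only [koszulH, koszulD, Finset.smul_sum]
    rw [Finset.sum_comm, ← Finset.sum_sub_distrib]
    refine Finset.sum_congr rfl fun μ _ => ?_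
    rw [Fin.sum_univ_succ, map_add, map_sum, sub_eq_add_neg, ← Finset.sum_neg_distrib]
    congr 1
    · simp [Function.comp_def]
    · refine Finset.sum_congr rfl fun i _ => ?_
      have : (Fin.cons μ w : Fin (m + 2) → ι) ∘ i.succ.succAbove =
          (Fin.cons μ (w ∘ i.succAbove) : Fin (m + 1) → ι) := by
        funext j
        refine Fin.cases ?_ (fun j => ?_) j <;> simp
      rw [this, Fin.cons_succ, map_smul, hcomm, Fin.val_succ, pow_succ, mul_neg_one, neg_smul]
  rw [h2]
  simp only [Finset.sum_add_distrib, smul_add, Finset.sum_ite_eq', Finset.mem_univ, if_true]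
  have h3 : ∀ i : Fin (m + 1), ((-1 : ℝ) ^ (i : ℕ)) • ε • c (Fin.cons (w i) (w ∘ i.succAbove)) =
      ε • c w := by
    intro i
    rw [hc.apply_cons_succAbove, smul_smul, smul_smul, mul_right_comm, ← mul_pow]
    simp
  simp only [h3, Finset.sum_const, Finset.card_univ, Fintype.card_fin]
  simp only [koszulD, koszulH, map_sum]
  rw [← Nat.cast_smul_eq_nsmul ℝ, smul_smul]
  push_cast
  rw [mul_comm ε]
  abel

/-- The operator `∑ μ, D_μ e_μ`. -/
def koszulEuler [Fintype ι] (D e : ι → V →ₗ[ℝ] V) : V →ₗ[ℝ] V := ∑ μ, D μ ∘ₗ e μ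

theorem koszulEuler_apply [Fintype ι] (D e : ι → V →ₗ[ℝ] V) (x : V) :
    koszulEuler D e x = ∑ μ, D μ (e μ x) := by
  simp [koszulEuler]

/-- Elements annihilated by all `k`-fold products of the operators `e`. -/
def loweringKer (e : ι → V →ₗ[ℝ] V) : ℕ → Submodule ℝ V
  | 0 => ⊥
  | k + 1 => ⨅ μ, (loweringKer e k).comap (e μ)

theorem mem_loweringKer_succ {e : ι → V →ₗ[ℝ] V} {k : ℕ} {x : V} :
    x ∈ loweringKer e (k + 1) ↔ ∀ μ, e μ x ∈ loweringKer e k := by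
  simp [loweringKer]

theorem koszulEuler_sub_mem_loweringKer [Fintype ι] [DecidableEq ι] {D e : ι → V →ₗ[ℝ] V}
    (hcomm : ∀ μ l x, e μ (D l x) = D l (e μ x) + if μ = l then x else 0)
    (he : ∀ μ ν x, e μ (e ν x) = e ν (e μ x)) (k : ℕ) :
    ∀ x ∈ loweringKer e (k + 1), koszulEuler D e x - (k : ℝ) • x ∈ loweringKer e k := by
  induction k with
  | zero =>
    intro x hx
    have h : ∀ μ, e μ x = 0 := fun μ => by simpa [loweringKer] using mem_loweringKer_succ.1 hx μ
    simp [koszulEuler_apply, h]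
  | succ k ih =>
    intro x hx
    refine mem_loweringKer_succ.2 fun μ => ?_
    convert ih (e μ x) (mem_loweringKer_succ.1 hx μ) using 1
    simp only [koszulEuler_apply, map_sub, map_sum, map_smul, hcomm, Finset.sum_add_distrib,
      Finset.sum_ite_eq, Finset.mem_univ, if_true, he μ]
    push_cast
    rw [add_smul, one_smul]
    abel

theorem koszulD_koszulEuler [Fintype ι] [DecidableEq ι] {D e : ι → V →ₗ[ℝ] V}
    (hcomm : ∀ μ l x, e μ (D l x) = D l (e μ x) + if μ = l then x else 0)
    (hD : ∀ μ ν x, D μ (D ν x) = D ν (D μ x)) {m : ℕ} (c : (Fin m → ι) → V)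
    (w : Fin (m + 1) → ι) :
    koszulD D (fun v => koszulEuler D e (c v)) w =
      koszulEuler D e (koszulD D c w) - koszulD D c w := by
  have h (l : ι) (x : V) : D l (koszulEuler D e x) = koszulEuler D e (D l x) - D l x := by
    have hite (μ : ι) : D μ (if μ = l then x else 0) = if μ = l then D l x else 0 := by
      split_ifs with h
      · rw [h]
      · exact map_zero _
    simp [koszulEuler_apply, hcomm, Finset.sum_add_distrib, hD l, hite]
  simp [koszulD, h, smul_sub, Finset.sum_sub_distrib]

/-- Exactness of the Koszul-type complex below the top degree, on elements killed by sufficiently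
many lowering operators, with control of a filtration `W`. -/
theorem exists_koszulD_eq [Fintype ι] [DecidableEq ι] {D e : ι → V →ₗ[ℝ] V}
    (hcomm : ∀ μ l x, e μ (D l x) = D l (e μ x) + if μ = l then x else 0)
    (he : ∀ μ ν x, e μ (e ν x) = e ν (e μ x)) (hD : ∀ μ ν x, D μ (D ν x) = D ν (D μ x))
    {W : ℕ → Submodule ℝ V} (hW : Monotone W) (hDW : ∀ μ q, ∀ x ∈ W q, D μ x ∈ W (q + 1))
    (heW : ∀ μ q, ∀ x ∈ W q, e μ x ∈ W q) {m : ℕ} (hm : m + 1 < Fintype.card ι) (k : ℕ) :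
    ∀ (q : ℕ) (c : (Fin (m + 1) → ι) → V), (∀ v, c v ∈ W q) → (∀ v, c v ∈ loweringKer e k) →
      IsAntisym c → koszulD D c = 0 →
      ∃ b : (Fin m → ι) → V, (∀ v, b v ∈ W (q + k)) ∧ IsAntisym b ∧ koszulD D b = c := by
  induction k with
  | zero =>
    intro q c _ hk _ _
    have hc : c = 0 := funext fun v => by simpa [loweringKer] using hk v
    refine ⟨0, fun v => Submodule.zero_mem _, fun v σ => by simp, ?_⟩
    funext w
    simp [koszulD, hc]
  | succ k ih =>
    intro q c hq hk hc hdc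
    set a : ℝ := (Fintype.card ι : ℝ) - (m + 1) + k with ha
    have ha0 : a ≠ 0 := by
      have : ((m + 1 : ℕ) : ℝ) < Fintype.card ι := by exact_mod_cast hm
      push_cast at this
      have : (0 : ℝ) ≤ k := k.cast_nonneg
      apply ne_of_gt
      linarith
    obtain ⟨b, hbW, hb, hdb⟩ := ih (q + 1)
      (fun v => (1 : ℝ) • koszulEuler D e (c v) + (-(k : ℝ)) • c v)
      (fun v => by
        refine Submodule.add_mem _ (Submodule.smul_mem _ _ ?_)
          (Submodule.smul_mem _ _ (hW q.le_succ (hq v)))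
        rw [koszulEuler_apply]
        exact Submodule.sum_mem _ fun μ _ => hDW μ q _ (heW μ q _ (hq v)))
      (fun v => by
        have := koszulEuler_sub_mem_loweringKer hcomm he k (c v) (hk v)
        rwa [one_smul, neg_smul, ← sub_eq_add_neg])
      ((hc.map _).add_smul hc _ _)
      (by
        rw [koszulD_add_smul]
        funext w
        rw [koszulD_koszulEuler hcomm hD, hdc]
        simp)
    refine ⟨fun v => a⁻¹ • koszulH e c v + (-a⁻¹) • b v, fun v => ?_,
      (hc.koszulH e).add_smul hb _ _, ?_⟩
    · refine Submodule.add_mem _ (Submodule.smul_mem _ _ ?_) (Submodule.smul_mem _ _ ?_)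
      · exact Submodule.sum_mem _ fun μ _ => hW (by omega) (heW μ q _ (hq _))
      · exact hW (by omega) (hbW v)
    · rw [koszulD_add_smul, hdb]
      funext w
      have h := koszulD_koszulH_add D e 1 (by simpa using hcomm) hc w
      have h0 : koszulH e (koszulD D c) w = 0 := by simp [hdc, koszulH]
      have h1 : ∑ μ, e μ (D μ (c w)) = koszulEuler D e (c w) + (Fintype.card ι : ℝ) • c w := by
        simp [koszulEuler_apply, hcomm, Finset.sum_add_distrib, Nat.cast_smul_eq_nsmul]
      rw [h0, add_zero, h1] at h
      rw [h]
      have : c w = (a⁻¹ * a) • c w := by rw [inv_mul_cancel₀ ha0, one_smul]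
      conv_rhs => rw [this, ha]
      simp only [one_mul]
      module

end Koszul

section Jets

variable {n p : ℕ}

/-- The truncation map as a linear map. -/
def truncLin (n p r : ℕ) : Jet n p →ₗ[ℝ] JTrunc n p r where
  toFun := trunc n p r
  map_add' _ _ := rfl
  map_smul' _ _ := rfl

theorem trunc_add (r : ℕ) (z v : Jet n p) : trunc n p r (z + v) = trunc n p r z + trunc n p r v :=
  rfl

theorem trunc_smul (r : ℕ) (s : ℝ) (v : Jet n p) : trunc n p r (s • v) = s • trunc n p r v :=
  rfl

/-- The restriction of truncations. -/
def restrTrunc (n p : ℕ) {r s : ℕ} (h : r ≤ s) : JTrunc n p s →L[ℝ] JTrunc n p r :=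
  LinearMap.toContinuousLinearMap
    { toFun := fun w => (w.1, fun i L => w.2 i fun μ => Fin.castLE (Nat.succ_le_succ h) (L μ))
      map_add' := fun _ _ => rfl
      map_smul' := fun _ _ => rfl }

theorem SmoothOfOrder.mono {r s : ℕ} (h : r ≤ s) {φ : Jet n p → ℝ} (hφ : SmoothOfOrder r φ) :
    SmoothOfOrder s φ := by
  obtain ⟨F, hF, rfl⟩ := hφ
  exact ⟨F ∘ restrTrunc n p h, hF.comp (restrTrunc n p h).contDiff, rfl⟩

theorem SmoothOfOrder.add {r : ℕ} {φ ψ : Jet n p → ℝ} (hφ : SmoothOfOrder r φ)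
    (hψ : SmoothOfOrder r ψ) : SmoothOfOrder r (φ + ψ) := by
  obtain ⟨F, hF, rfl⟩ := hφ
  obtain ⟨G, hG, rfl⟩ := hψ
  exact ⟨F + G, hF.add hG, rfl⟩

theorem SmoothOfOrder.mul {r : ℕ} {φ ψ : Jet n p → ℝ} (hφ : SmoothOfOrder r φ)
    (hψ : SmoothOfOrder r ψ) : SmoothOfOrder r (φ * ψ) := by
  obtain ⟨F, hF, rfl⟩ := hφ
  obtain ⟨G, hG, rfl⟩ := hψ
  exact ⟨F * G, hF.mul hG, rfl⟩

theorem smoothOfOrder_const (r : ℕ) (a : ℝ) : SmoothOfOrder r (fun _ : Jet n p => a) :=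
  ⟨fun _ => a, contDiff_const, rfl⟩

theorem SmoothOfOrder.smul {r : ℕ} {φ : Jet n p → ℝ} (hφ : SmoothOfOrder r φ) (a : ℝ) :
    SmoothOfOrder r (a • φ) :=
  (smoothOfOrder_const r a).mul hφ

/-- The functions of finite jet order. -/
def finiteOrder (n p : ℕ) : Submodule ℝ (Jet n p → ℝ) where
  carrier := {φ | FiniteOrderSmooth φ}
  add_mem' := fun ⟨r, hr⟩ ⟨s, hs⟩ =>
    ⟨max r s, (hr.mono (le_max_left r s)).add (hs.mono (le_max_right r s))⟩
  zero_mem' := ⟨0, smoothOfOrder_const 0 0⟩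
  smul_mem' a _ := fun ⟨r, hr⟩ => ⟨r, hr.smul a⟩

theorem hasLineDerivAt_comp_trunc {r : ℕ} {F : JTrunc n p r → ℝ} (hF : ContDiff ℝ (⊤ : ℕ∞) F)
    (z v : Jet n p) :
    HasLineDerivAt ℝ (F ∘ trunc n p r) (fderiv ℝ F (trunc n p r z) (trunc n p r v)) z v := by
  have h := ((hF.differentiable (by simp)) (trunc n p r z)).hasFDerivAt.hasLineDerivAt
    (trunc n p r v)
  exact h

theorem lineDeriv_comp_trunc {r : ℕ} {F : JTrunc n p r → ℝ} (hF : ContDiff ℝ (⊤ : ℕ∞) F)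
    (z v : Jet n p) :
    lineDeriv ℝ (F ∘ trunc n p r) z v = fderiv ℝ F (trunc n p r z) (trunc n p r v) :=
  (hasLineDerivAt_comp_trunc hF z v).lineDeriv

theorem FiniteOrderSmooth.hasLineDerivAt {φ : Jet n p → ℝ} (hφ : FiniteOrderSmooth φ)
    (z v : Jet n p) : HasLineDerivAt ℝ φ (lineDeriv ℝ φ z v) z v := by
  obtain ⟨r, F, hF, rfl⟩ := hφ
  exact (hasLineDerivAt_comp_trunc hF z v).lineDifferentiableAt.hasLineDerivAt

/-- The value at `z` of the total derivative seen as a vector field on the jet space. -/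
def totalVec (l : Fin n) (z : Jet n p) : Jet n p :=
  (Pi.single l 1, fun i L => z.2 i (L + Pi.single l 1))

/-- The linear part of `totalVec`. -/
def shiftLin (l : Fin n) : Jet n p →ₗ[ℝ] Jet n p where
  toFun z := (0, fun i L => z.2 i (L + Pi.single l 1))
  map_add' z w := by ext <;> simp
  map_smul' a z := by ext <;> simp

theorem totalVec_add (l : Fin n) (z v : Jet n p) :
    totalVec l (z + v) = totalVec l z + shiftLin l v := by
  ext <;> simp [totalVec, shiftLin]

/-- The coordinate direction `∂/∂y^i_Λ` in the jet space. -/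
def fiberVec (i : Fin p) (L : Fin n → ℕ) : Jet n p := (0, Pi.single i (Pi.single L 1))

/-- The coordinate direction `∂/∂x^λ` in the jet space. -/
def baseVec (l : Fin n) : Jet n p := (Pi.single l 1, 0)

theorem trunc_fiberVec {r : ℕ} (i : Fin p) (L : Fin n → Fin (r + 1)) :
    trunc n p r (fiberVec i fun μ => (L μ : ℕ)) = ydir i L := by
  refine Prod.ext rfl (funext fun i' => funext fun L' => ?_)
  have h : ((fun μ => (L' μ : ℕ)) = fun μ => (L μ : ℕ)) ↔ L' = L := by
    simp [funext_iff, Fin.ext_iff]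
  by_cases hi : i' = i
  · subst hi
    simp [trunc, fiberVec, ydir, Pi.single_apply, h]
  · simp [trunc, fiberVec, ydir, hi]

theorem trunc_fiberVec_eq_zero {r : ℕ} (i : Fin p) (L : Fin n → ℕ) (hL : ¬ ∀ μ, L μ ≤ r) :
    trunc n p r (fiberVec i L) = 0 := by
  refine Prod.ext rfl (funext fun i' => funext fun L' => ?_)
  have h : (fun μ => (L' μ : ℕ)) ≠ L := by
    rintro rfl
    exact hL fun μ => Nat.lt_succ_iff.1 (L' μ).2
  by_cases hi : i' = i
  · subst hi
    simp [trunc, fiberVec, h]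
  · simp [trunc, fiberVec, hi]

theorem trunc_base_add_sum {r : ℕ} (w : JTrunc n p r) :
    w = (w.1, 0) + ∑ i : Fin p, ∑ L : Fin n → Fin (r + 1), w.2 i L • ydir i L := by
  have h1 :
      (∑ i : Fin p, ∑ L : Fin n → Fin (r + 1), w.2 i L • (ydir i L : JTrunc n p r)).1 = 0 := by
    simp [Prod.fst_sum, ydir]
  have h2 : (∑ i : Fin p, ∑ L : Fin n → Fin (r + 1), w.2 i L • (ydir i L : JTrunc n p r)).2
      = w.2 := by
    funext i L
    simp [Prod.snd_sum, ydir, Finset.sum_apply, Pi.single_apply, Finset.sum_ite_eq, ite_apply]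
  refine Prod.ext ?_ ?_
  · rw [Prod.fst_add, h1, add_zero]
  · rw [Prod.snd_add, h2, zero_add]

theorem totalDeriv_eq_lineDeriv (l : Fin n) {φ : Jet n p → ℝ} (hφ : FiniteOrderSmooth φ) :
    totalDeriv l φ = fun z => lineDeriv ℝ φ z (totalVec l z) := by
  funext z
  rw [totalDeriv, dif_pos hφ]
  have hs := hφ.choose_spec.choose_spec
  conv_rhs => rw [hs.2]
  rw [lineDeriv_comp_trunc hs.1, trunc_base_add_sum (trunc n p _ (totalVec l z)), map_add, map_sum]
  simp only [map_sum, map_smul, smul_eq_mul]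
  have h (r : ℕ) (L : Fin n → Fin (r + 1)) :
      (fun μ => (L μ : ℕ)) + Pi.single l 1 = addIdx L l := by
    funext μ
    simp [addIdx, Pi.single_apply]
  simp only [trunc, totalVec, h]
  congr 2

theorem SmoothOfOrder.lineDeriv_totalVec {r : ℕ} {φ : Jet n p → ℝ} (hφ : SmoothOfOrder r φ)
    (l : Fin n) : SmoothOfOrder (r + 1) (fun z => lineDeriv ℝ φ z (totalVec l z)) := by
  obtain ⟨F, hF, rfl⟩ := hφ
  let B : JTrunc n p (r + 1) →L[ℝ] JTrunc n p r := LinearMap.toContinuousLinearMap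
    { toFun := fun w => (0, fun i L => w.2 i fun μ => ⟨addIdx L l μ, by
        have := (L μ).2
        simp only [addIdx]
        split_ifs <;> omega⟩)
      map_add' := fun v w => by ext <;> simp
      map_smul' := fun a w => by ext <;> simp }
  have hB : ∀ z, trunc n p r (totalVec l z) = xdir l + B (trunc n p (r + 1) z) := by
    intro z
    refine Prod.ext (by simp [B, trunc, totalVec, xdir]) (funext fun i => funext fun L => ?_)
    have : (fun μ => (L μ : ℕ)) + Pi.single l 1 = addIdx L l := by
      funext μ
      simp [addIdx, Pi.single_apply]
    simp [B, trunc, totalVec, xdir, this]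
  refine ⟨fun w => fderiv ℝ F (restrTrunc n p r.le_succ w) (xdir l + B w), ?_, ?_⟩
  · exact ((hF.fderiv_right (m := (⊤ : ℕ∞)) (by simp)).comp
      (restrTrunc n p r.le_succ).contDiff).clm_apply (contDiff_const.add B.contDiff)
  · funext z
    rw [lineDeriv_comp_trunc hF, hB]
    rfl

theorem SmoothOfOrder.totalDeriv {r : ℕ} {φ : Jet n p → ℝ} (hφ : SmoothOfOrder r φ)
    (l : Fin n) : SmoothOfOrder (r + 1) (totalDeriv l φ) := by
  rw [totalDeriv_eq_lineDeriv l ⟨r, hφ⟩]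
  exact hφ.lineDeriv_totalVec l

theorem SmoothOfOrder.lineDeriv_const {r : ℕ} {φ : Jet n p → ℝ} (hφ : SmoothOfOrder r φ)
    (v : Jet n p) : SmoothOfOrder r (fun z => lineDeriv ℝ φ z v) := by
  obtain ⟨F, hF, rfl⟩ := hφ
  refine ⟨fun w => fderiv ℝ F w (trunc n p r v), ?_, funext fun z => lineDeriv_comp_trunc hF z v⟩
  exact (hF.fderiv_right (m := (⊤ : ℕ∞)) (by simp)).clm_apply contDiff_const

/-- Differentiating `φ` along an affine vector field `X` with linear part `B`. -/
theorem lineDeriv_lineDeriv_affine {φ : Jet n p → ℝ} (hφ : FiniteOrderSmooth φ)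
    {X : Jet n p → Jet n p} {B : Jet n p →ₗ[ℝ] Jet n p} (hX : ∀ z v, X (z + v) = X z + B v)
    (z v : Jet n p) :
    lineDeriv ℝ (fun z => lineDeriv ℝ φ z (X z)) z v =
      lineDeriv ℝ (fun z' => lineDeriv ℝ φ z' (X z)) z v + lineDeriv ℝ φ z (B v) := by
  obtain ⟨r, F, hF, rfl⟩ := hφ
  simp only [lineDeriv_comp_trunc hF]
  have hd : HasDerivAt (fun t : ℝ => fderiv ℝ F (trunc n p r z + t • trunc n p r v))
      (fderiv ℝ (fderiv ℝ F) (trunc n p r z) (trunc n p r v)) 0 := by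
    have h : Differentiable ℝ (fderiv ℝ F) :=
      (hF.fderiv_right (m := (⊤ : ℕ∞)) (by simp)).differentiable (by simp)
    exact (h _).hasFDerivAt.hasLineDerivAt _
  have hc (u : JTrunc n p r) : HasDerivAt (fun t : ℝ => u + t • trunc n p r (B v))
      (trunc n p r (B v)) 0 := by
    simpa using ((hasDerivAt_id (0 : ℝ)).smul_const (trunc n p r (B v))).const_add u
  have h1 := hd.clm_apply (hc (trunc n p r (X z)))
  have h2 := hd.clm_apply (hasDerivAt_const (0 : ℝ) (trunc n p r (X z)))
  simp only [zero_smul, add_zero, map_zero] at h1 h2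
  simp only [lineDeriv, hX, map_smul, trunc_add, trunc_smul]
  rw [h1.deriv, h2.deriv]

theorem lineDeriv_lineDeriv_comm {φ : Jet n p → ℝ} (hφ : FiniteOrderSmooth φ) (z u v : Jet n p) :
    lineDeriv ℝ (fun z' => lineDeriv ℝ φ z' u) z v =
      lineDeriv ℝ (fun z' => lineDeriv ℝ φ z' v) z u := by
  obtain ⟨r, F, hF, rfl⟩ := hφ
  have hdd : ContDiff ℝ (⊤ : ℕ∞) (fderiv ℝ F) := hF.fderiv_right (m := (⊤ : ℕ∞)) (by simp)
  have key (u v : Jet n p) : lineDeriv ℝ (fun z' => lineDeriv ℝ (F ∘ trunc n p r) z' u) z v =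
      fderiv ℝ (fderiv ℝ F) (trunc n p r z) (trunc n p r v) (trunc n p r u) := by
    simp only [lineDeriv_comp_trunc hF]
    have h := lineDeriv_comp_trunc (F := fun w => fderiv ℝ F w (trunc n p r u))
      (hdd.clm_apply contDiff_const) z v
    rw [Function.comp_def] at h
    rw [h, fderiv_clm_apply ((hdd.differentiable (by simp)) _) (differentiableAt_const _)]
    simp
  rw [key, key]
  exact (hF.contDiffAt.isSymmSndFDerivAt
    (by simp only [minSmoothness_of_isRCLikeNormedField]
        exact WithTop.coe_le_coe.2 (le_top : (2 : ℕ∞) ≤ ⊤))) _ _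

theorem lineDeriv_sum_smul {φ : Jet n p → ℝ} (hφ : FiniteOrderSmooth φ) (z : Jet n p)
    {κ : Type*} (s : Finset κ) (a : κ → ℝ) (v : κ → Jet n p) :
    lineDeriv ℝ φ z (∑ k ∈ s, a k • v k) = ∑ k ∈ s, a k * lineDeriv ℝ φ z (v k) := by
  obtain ⟨r, F, hF, rfl⟩ := hφ
  simp only [lineDeriv_comp_trunc hF]
  have : trunc n p r (∑ k ∈ s, a k • v k) = ∑ k ∈ s, a k • trunc n p r (v k) :=
    map_sum (truncLin n p r) (fun k => a k • v k) s
  rw [this, map_sum]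
  simp

theorem shiftLin_totalVec_comm (l μ : Fin n) (z : Jet n p) :
    shiftLin l (totalVec μ z) = shiftLin μ (totalVec l z) := by
  refine Prod.ext rfl (funext fun i => funext fun L => ?_)
  simp only [shiftLin, totalVec, LinearMap.coe_mk, AddHom.coe_mk]
  rw [add_right_comm]

theorem totalDeriv_comm {φ : Jet n p → ℝ} (hφ : FiniteOrderSmooth φ) (l μ : Fin n) :
    totalDeriv l (totalDeriv μ φ) = totalDeriv μ (totalDeriv l φ) := by
  obtain ⟨r, hr⟩ := hφ
  rw [totalDeriv_eq_lineDeriv l ⟨_, hr.totalDeriv μ⟩,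
    totalDeriv_eq_lineDeriv μ ⟨_, hr.totalDeriv l⟩,
    totalDeriv_eq_lineDeriv l ⟨_, hr⟩, totalDeriv_eq_lineDeriv μ ⟨_, hr⟩]
  funext z
  rw [lineDeriv_lineDeriv_affine ⟨r, hr⟩ (totalVec_add μ),
    lineDeriv_lineDeriv_affine ⟨r, hr⟩ (totalVec_add l),
    lineDeriv_lineDeriv_comm ⟨r, hr⟩, shiftLin_totalVec_comm]

theorem shiftLin_fiberVec (l : Fin n) (i : Fin p) (L : Fin n → ℕ) :
    shiftLin l (fiberVec i L) = if L l = 0 then 0 else fiberVec i (L - Pi.single l 1) := by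
  have h (L' : Fin n → ℕ) : L' + Pi.single l 1 = L ↔ L l ≠ 0 ∧ L' = L - Pi.single l 1 := by
    constructor
    · rintro rfl
      simp
    · rintro ⟨h0, rfl⟩
      refine tsub_add_cancel_of_le fun μ => ?_
      by_cases hμ : μ = l
      · subst hμ
        simp
        omega
      · simp [hμ]
  refine Prod.ext (by split_ifs <;> rfl) (funext fun i' => funext fun L' => ?_)
  by_cases hi : i' = i
  · subst hi
    by_cases hL : L l = 0
    · simp [shiftLin, fiberVec, Pi.single_apply, h, hL]
    · simp [shiftLin, fiberVec, Pi.single_apply, h, hL]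
  · split_ifs <;> simp [shiftLin, fiberVec, hi]

theorem lineDeriv_fiberVec_totalDeriv {φ : Jet n p → ℝ} (hφ : FiniteOrderSmooth φ) (l : Fin n)
    (i : Fin p) (L : Fin n → ℕ) (z : Jet n p) :
    lineDeriv ℝ (totalDeriv l φ) z (fiberVec i L) =
      totalDeriv l (fun z => lineDeriv ℝ φ z (fiberVec i L)) z +
        if L l = 0 then 0 else lineDeriv ℝ φ z (fiberVec i (L - Pi.single l 1)) := by
  obtain ⟨r, hr⟩ := hφ
  rw [totalDeriv_eq_lineDeriv l ⟨_, hr.lineDeriv_const _⟩, totalDeriv_eq_lineDeriv l ⟨_, hr⟩,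
    lineDeriv_lineDeriv_affine ⟨r, hr⟩ (totalVec_add l), lineDeriv_lineDeriv_comm ⟨r, hr⟩,
    shiftLin_fiberVec]
  split_ifs
  · simp [lineDeriv]
  · rfl

/-- The total derivative as an endomorphism of the space of functions of finite jet order. -/
def totalDerivLin (l : Fin n) : finiteOrder n p →ₗ[ℝ] finiteOrder n p where
  toFun φ := ⟨totalDeriv l φ.1, φ.2.elim fun r hr => ⟨r + 1, hr.totalDeriv l⟩⟩
  map_add' φ ψ := by
    refine Subtype.ext ?_
    simp only [Submodule.coe_add]
    rw [totalDeriv_eq_lineDeriv l φ.2, totalDeriv_eq_lineDeriv l ψ.2,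
      totalDeriv_eq_lineDeriv l ((finiteOrder n p).add_mem φ.2 ψ.2)]
    funext z
    exact HasDerivAt.deriv ((φ.2.hasLineDerivAt z _).add (ψ.2.hasLineDerivAt z _))
  map_smul' a φ := by
    refine Subtype.ext ?_
    simp only [RingHom.id_apply, Submodule.coe_smul]
    rw [totalDeriv_eq_lineDeriv l φ.2, totalDeriv_eq_lineDeriv l ((finiteOrder n p).smul_mem a φ.2)]
    funext z
    exact HasDerivAt.deriv ((φ.2.hasLineDerivAt z _).const_smul a)

theorem coe_totalDerivLin (l : Fin n) (φ : finiteOrder n p) :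
    (totalDerivLin l φ : Jet n p → ℝ) = totalDeriv l φ := rfl

theorem coe_koszulD_totalDerivLin {m : ℕ} (c : (Fin m → Fin n) → finiteOrder n p)
    (w : Fin (m + 1) → Fin n) :
    ((koszulD totalDerivLin c w : finiteOrder n p) : Jet n p → ℝ) =
      dHform (fun v => (c v : Jet n p → ℝ)) w := by
  simp [koszulD, dHform, coe_totalDerivLin]

/-- Vertical one-forms `∑ f^i_Λ dy^i_Λ` with coefficients of finite jet order, with no finiteness
condition on the set of nonzero coefficients. -/
abbrev VertForm (n p : ℕ) := Fin p → (Fin n → ℕ) → finiteOrder n p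

/-- The vertical differential. -/
def vertDiff : finiteOrder n p →ₗ[ℝ] VertForm n p where
  toFun φ i L := ⟨fun z => lineDeriv ℝ φ.1 z (fiberVec i L),
    φ.2.elim fun r hr => ⟨r, hr.lineDeriv_const _⟩⟩
  map_add' φ ψ := by
    funext i L
    refine Subtype.ext (funext fun z => ?_)
    exact HasDerivAt.deriv ((φ.2.hasLineDerivAt z _).add (ψ.2.hasLineDerivAt z _))
  map_smul' a φ := by
    funext i L
    refine Subtype.ext (funext fun z => ?_)
    exact HasDerivAt.deriv ((φ.2.hasLineDerivAt z _).const_smul a)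

theorem vertDiff_apply (φ : finiteOrder n p) (i : Fin p) (L : Fin n → ℕ) (z : Jet n p) :
    (vertDiff φ i L).1 z = lineDeriv ℝ φ.1 z (fiberVec i L) := rfl

/-- The total derivative acting on vertical one-forms. -/
def vertTotal (l : Fin n) : VertForm n p →ₗ[ℝ] VertForm n p where
  toFun f i L := totalDerivLin l (f i L) + if L l = 0 then 0 else f i (L - Pi.single l 1)
  map_add' f g := by
    funext i L
    simp only [Pi.add_apply, map_add]
    split_ifs
    · simp
    · abel
  map_smul' a f := by
    funext i L
    simp only [Pi.smul_apply, map_smul, RingHom.id_apply, smul_add, smul_ite, smul_zero]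

/-- The operator lowering the multi-indices of vertical one-forms. -/
def vertLower (μ : Fin n) : VertForm n p →ₗ[ℝ] VertForm n p where
  toFun f i L := ((L μ : ℝ) + 1) • f i (L + Pi.single μ 1)
  map_add' f g := by
    funext i L
    simp only [Pi.add_apply, smul_add]
  map_smul' a f := by
    funext i L
    simp only [Pi.smul_apply, RingHom.id_apply, smul_comm a]

theorem vertTotal_apply (l : Fin n) (f : VertForm n p) (i : Fin p) (L : Fin n → ℕ) :
    vertTotal l f i L =
      totalDerivLin l (f i L) + if L l = 0 then 0 else f i (L - Pi.single l 1) := rfl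

theorem vertLower_apply (μ : Fin n) (f : VertForm n p) (i : Fin p) (L : Fin n → ℕ) :
    vertLower μ f i L = ((L μ : ℝ) + 1) • f i (L + Pi.single μ 1) := rfl

theorem vertDiff_totalDerivLin (l : Fin n) (φ : finiteOrder n p) :
    vertDiff (totalDerivLin l φ) = vertTotal l (vertDiff φ) := by
  funext i L
  refine Subtype.ext (funext fun z => ?_)
  rw [vertDiff_apply, coe_totalDerivLin, lineDeriv_fiberVec_totalDeriv φ.2, vertTotal_apply]
  split_ifs <;> rfl

theorem vertLower_comm (μ ν : Fin n) (f : VertForm n p) :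
    vertLower μ (vertLower ν f) = vertLower ν (vertLower μ f) := by
  by_cases h : μ = ν
  · rw [h]
  funext i L
  simp only [vertLower_apply, Pi.add_apply, Pi.single_eq_of_ne h, Pi.single_eq_of_ne (Ne.symm h),
    add_zero]
  rw [smul_comm, add_right_comm]

theorem totalDerivLin_comm (l μ : Fin n) (φ : finiteOrder n p) :
    totalDerivLin l (totalDerivLin μ φ) = totalDerivLin μ (totalDerivLin l φ) :=
  Subtype.ext (totalDeriv_comm φ.2 l μ)

theorem vertTotal_comm (l μ : Fin n) (f : VertForm n p) :
    vertTotal l (vertTotal μ f) = vertTotal μ (vertTotal l f) := by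
  by_cases h : l = μ
  · rw [h]
  funext i L
  simp only [vertTotal_apply, map_add, Pi.sub_apply, Pi.single_eq_of_ne h,
    Pi.single_eq_of_ne (Ne.symm h), tsub_zero]
  rw [totalDerivLin_comm, tsub_right_comm]
  split_ifs <;> try simp only [map_zero, add_zero]
  abel

theorem vertLower_vertTotal (μ l : Fin n) (f : VertForm n p) :
    vertLower μ (vertTotal l f) = vertTotal l (vertLower μ f) + if μ = l then f else 0 := by
  funext i L
  simp only [vertLower_apply, vertTotal_apply, Pi.add_apply, map_smul, smul_add]
  by_cases h : μ = l
  · subst h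
    by_cases hL : L μ = 0
    · simp [hL]
    · have h1 : L - Pi.single μ 1 + Pi.single μ 1 = L := by
        refine tsub_add_cancel_of_le fun ν => ?_
        by_cases hν : ν = μ
        · subst hν
          simp
          omega
        · simp [hν]
      have h2 : ((L μ - 1 : ℕ) : ℝ) + 1 = L μ := by
        rw [← Nat.cast_succ, Nat.succ_eq_add_one, Nat.sub_add_cancel (Nat.pos_of_ne_zero hL)]
      simp [hL, h1, h2, add_smul, add_assoc]
  · by_cases hL : L l = 0
    · simp [hL, h, Ne.symm h]
    · have h1 : L + Pi.single μ 1 - Pi.single l 1 = L - Pi.single l 1 + Pi.single μ 1 := by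
        funext ν
        have : L l ≠ 0 := hL
        by_cases hν : ν = l
        · subst hν
          simp [Ne.symm h]
        · simp [hν]
      simp [hL, h, Ne.symm h, h1]

/-- Vertical forms involving only the coordinates `y^i_Λ` with entries of `Λ` at most `q`, with
coefficients of jet order at most `q`. -/
def vertOrderLE (n p q : ℕ) : Submodule ℝ (VertForm n p) where
  carrier := {f | ∀ i L, SmoothOfOrder q (f i L).1 ∧ ((¬ ∀ μ, L μ ≤ q) → f i L = 0)}
  add_mem' hf hg i L := ⟨(hf i L).1.add (hg i L).1, fun h => by
    rw [Pi.add_apply, Pi.add_apply, (hf i L).2 h, (hg i L).2 h, add_zero]⟩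
  zero_mem' i L := ⟨smoothOfOrder_const q 0, fun _ => rfl⟩
  smul_mem' a f hf i L := ⟨(hf i L).1.smul a, fun h => by
    rw [Pi.smul_apply, Pi.smul_apply, (hf i L).2 h, smul_zero]⟩

theorem vertOrderLE_mono : Monotone (vertOrderLE n p) := fun _ _ h _ hf i L =>
  ⟨(hf i L).1.mono h, fun hL => (hf i L).2 fun hL' => hL fun μ => (hL' μ).trans h⟩

theorem vertTotal_mem (l : Fin n) (q : ℕ) (f : VertForm n p) (hf : f ∈ vertOrderLE n p q) :
    vertTotal l f ∈ vertOrderLE n p (q + 1) := by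
  intro i L
  have h0 : SmoothOfOrder (q + 1) ((if L l = 0 then 0 else f i (L - Pi.single l 1) :
      finiteOrder n p) : Jet n p → ℝ) := by
    split_ifs
    · exact smoothOfOrder_const _ 0
    · exact (hf i _).1.mono q.le_succ
  refine ⟨((hf i L).1.totalDeriv l).add h0, fun hL => ?_⟩
  rw [vertTotal_apply, (hf i L).2 fun h => hL fun μ => (h μ).trans q.le_succ, map_zero, zero_add,
    (hf i _).2, ite_self]
  intro h
  refine hL fun μ => ?_
  have := h μ
  by_cases hμ : μ = l
  · subst hμ
    simp at this
    omega
  · simp [hμ] at this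
    omega

theorem vertLower_mem (μ : Fin n) (q : ℕ) (f : VertForm n p) (hf : f ∈ vertOrderLE n p q) :
    vertLower μ f ∈ vertOrderLE n p q := by
  intro i L
  refine ⟨(hf i _).1.smul _, fun hL => ?_⟩
  rw [vertLower_apply, (hf i _).2, smul_zero]
  exact fun h => hL fun ν => le_trans (Nat.le_add_right _ _) (h ν)

theorem mem_loweringKer_vertLower (k : ℕ) : ∀ f : VertForm n p,
    (∀ i L, k ≤ ∑ μ, L μ → f i L = 0) → f ∈ loweringKer vertLower k := by
  induction k with
  | zero =>
    exact fun f h => (Submodule.mem_bot ℝ).2 (funext fun i => funext fun L => h i L (zero_le))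
  | succ k ih =>
    refine fun f h => mem_loweringKer_succ.2 fun μ => ih _ fun i L hL => ?_
    rw [vertLower_apply, h, smul_zero]
    simpa [Finset.sum_add_distrib] using hL

theorem mem_loweringKer_of_mem_vertOrderLE {q : ℕ} {f : VertForm n p}
    (hf : f ∈ vertOrderLE n p q) : f ∈ loweringKer vertLower (n * q + 1) := by
  refine mem_loweringKer_vertLower _ f fun i L hL => (hf i L).2 fun h => ?_
  have : ∑ μ, L μ ≤ ∑ _μ : Fin n, q := Finset.sum_le_sum fun μ _ => h μ
  simp at this
  omega

theorem vertDiff_mem {q : ℕ} {φ : finiteOrder n p} (hφ : SmoothOfOrder q φ.1) :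
    vertDiff φ ∈ vertOrderLE n p q := by
  refine fun i L => ⟨hφ.lineDeriv_const _, fun hL => Subtype.ext (funext fun z => ?_)⟩
  obtain ⟨F, hF, h⟩ := hφ
  rw [vertDiff_apply, h, lineDeriv_comp_trunc hF, trunc_fiberVec_eq_zero i L hL, map_zero]
  rfl

theorem exists_koszulD_vertTotal_eq {m : ℕ} (hmn : m + 1 < n) (r : ℕ)
    {c : (Fin (m + 1) → Fin n) → finiteOrder n p} (hr : ∀ v, SmoothOfOrder r (c v).1)
    (hc : IsAntisym c) (hd : koszulD totalDerivLin c = 0) :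
    ∃ b : (Fin m → Fin n) → VertForm n p, (∀ v, b v ∈ vertOrderLE n p (r + (n * r + 1))) ∧
      IsAntisym b ∧ koszulD vertTotal b = fun w => vertDiff (c w) := by
  refine exists_koszulD_eq (fun μ l f => ?_) vertLower_comm vertTotal_comm vertOrderLE_mono
    vertTotal_mem vertLower_mem (by simpa using hmn) _ r _ (fun v => vertDiff_mem (hr v))
    (fun v => mem_loweringKer_of_mem_vertOrderLE (vertDiff_mem (hr v))) (hc.map _) ?_
  · rw [vertLower_vertTotal]
  · funext w
    have h := congrArg vertDiff (congrFun hd w)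
    simpa [koszulD, vertDiff_totalDerivLin] using h

/-- A smooth one-parameter family of functions of jet order at most `r`. -/
def SmoothFamily (r : ℕ) (Φ : ℝ → Jet n p → ℝ) : Prop :=
  ∃ G : ℝ × JTrunc n p r → ℝ, ContDiff ℝ (⊤ : ℕ∞) G ∧ ∀ t z, Φ t z = G (t, trunc n p r z)

theorem SmoothFamily.smoothOfOrder {r : ℕ} {Φ : ℝ → Jet n p → ℝ} (hΦ : SmoothFamily r Φ) (t : ℝ) :
    SmoothOfOrder r (Φ t) := by
  obtain ⟨G, hG, h⟩ := hΦ
  exact ⟨fun w => G (t, w), hG.comp (contDiff_prodMk_right t), funext (h t)⟩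

theorem SmoothFamily.sum {r : ℕ} {κ : Type*} (s : Finset κ) {Φ : κ → ℝ → Jet n p → ℝ}
    (hΦ : ∀ k ∈ s, SmoothFamily r (Φ k)) : SmoothFamily r (fun t z => ∑ k ∈ s, Φ k t z) := by
  choose! G hG h using hΦ
  exact ⟨fun q => ∑ k ∈ s, G k q, ContDiff.sum hG,
    fun t z => Finset.sum_congr rfl fun k hk => h k hk t z⟩

theorem SmoothFamily.mul {r : ℕ} {Φ Ψ : ℝ → Jet n p → ℝ} (hΦ : SmoothFamily r Φ)
    (hΨ : SmoothFamily r Ψ) : SmoothFamily r (fun t z => Φ t z * Ψ t z) := by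
  obtain ⟨G, hG, h⟩ := hΦ
  obtain ⟨G', hG', h'⟩ := hΨ
  exact ⟨fun q => G q * G' q, hG.mul hG', fun t z => by simp only [h, h']⟩

theorem smoothFamily_of_contDiff (r : ℕ) {g : ℝ → ℝ} (hg : ContDiff ℝ (⊤ : ℕ∞) g) :
    SmoothFamily r (fun t (_ : Jet n p) => g t) :=
  ⟨fun q => g q.1, hg.comp contDiff_fst, fun _ _ => rfl⟩

theorem SmoothOfOrder.smoothFamily {r : ℕ} {φ : Jet n p → ℝ} (hφ : SmoothOfOrder r φ) :
    SmoothFamily r (fun _ => φ) := by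
  obtain ⟨F, hF, rfl⟩ := hφ
  exact ⟨fun q => F q.2, hF.comp contDiff_snd, fun _ _ => rfl⟩

theorem SmoothFamily.continuous_apply {r : ℕ} {Φ : ℝ → Jet n p → ℝ} (hΦ : SmoothFamily r Φ)
    (z : Jet n p) : Continuous fun t => Φ t z := by
  obtain ⟨G, hG, h⟩ := hΦ
  simp only [h]
  exact hG.continuous.comp (by fun_prop)

theorem SmoothFamily.integral {r : ℕ} {Φ : ℝ → Jet n p → ℝ} (hΦ : SmoothFamily r Φ) :
    SmoothOfOrder r (fun z => ∫ t in (0 : ℝ)..1, Φ t z) := by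
  obtain ⟨G, hG, h⟩ := hΦ
  exact ⟨_, contDiff_top_intervalIntegral hG, by simp only [h]; rfl⟩

theorem totalDeriv_eq_fderiv_of_family {r : ℕ} {G : ℝ × JTrunc n p r → ℝ}
    (hG : ContDiff ℝ (⊤ : ℕ∞) G) (l : Fin n) (t : ℝ) (z : Jet n p) :
    totalDeriv l (fun z => G (t, trunc n p r z)) z =
      ((fderiv ℝ G (t, trunc n p r z)).comp (ContinuousLinearMap.inr ℝ ℝ (JTrunc n p r)))
        (trunc n p r (totalVec l z)) := by
  have hF : ContDiff ℝ (⊤ : ℕ∞) fun w => G (t, w) := hG.comp (contDiff_prodMk_right t)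
  have h1 : HasFDerivAt (fun w => G (t, w)) ((fderiv ℝ G (t, trunc n p r z)).comp
      (ContinuousLinearMap.inr ℝ ℝ (JTrunc n p r))) (trunc n p r z) :=
    ((hG.differentiable (by simp) (t, trunc n p r z)).hasFDerivAt).comp (trunc n p r z)
      (hasFDerivAt_prodMk_right t (trunc n p r z))
  have hfo : FiniteOrderSmooth fun z => G (t, trunc n p r z) := ⟨r, _, hF, rfl⟩
  rw [totalDeriv_eq_lineDeriv l hfo]
  refine (lineDeriv_comp_trunc hF z _).trans ?_
  rw [h1.fderiv]

theorem SmoothFamily.continuous_totalDeriv {r : ℕ} {Φ : ℝ → Jet n p → ℝ} (hΦ : SmoothFamily r Φ)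
    (l : Fin n) (z : Jet n p) : Continuous fun t => totalDeriv l (Φ t) z := by
  obtain ⟨G, hG, h⟩ := hΦ
  have h' (t : ℝ) : Φ t = fun z => G (t, trunc n p r z) := funext (h t)
  simp only [h', totalDeriv_eq_fderiv_of_family hG]
  exact ((contDiff_fderiv_comp_inr hG).continuous.comp
    (by fun_prop : Continuous fun t : ℝ => (t, trunc n p r z))).clm_apply continuous_const

theorem SmoothFamily.totalDeriv_integral {r : ℕ} {Φ : ℝ → Jet n p → ℝ} (hΦ : SmoothFamily r Φ)
    (l : Fin n) (z : Jet n p) :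
    totalDeriv l (fun z => ∫ t in (0 : ℝ)..1, Φ t z) z =
      ∫ t in (0 : ℝ)..1, totalDeriv l (Φ t) z := by
  obtain ⟨G, hG, h⟩ := hΦ
  have h' (t : ℝ) : Φ t = fun z => G (t, trunc n p r z) := funext (h t)
  simp only [h', totalDeriv_eq_fderiv_of_family hG]
  have hfo : FiniteOrderSmooth fun z => ∫ t in (0 : ℝ)..1, G (t, trunc n p r z) :=
    ⟨r, _, contDiff_top_intervalIntegral hG, rfl⟩
  rw [totalDeriv_eq_lineDeriv l hfo]
  refine (lineDeriv_comp_trunc (contDiff_top_intervalIntegral hG) z _).trans ?_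
  rw [(hasFDerivAt_intervalIntegral_of_contDiff
    (hG.of_le (by exact_mod_cast le_top)) (trunc n p r z)).fderiv]
  refine ContinuousLinearMap.intervalIntegral_apply ?_ _
  exact ((contDiff_fderiv_comp_inr hG).continuous.comp
    (by fun_prop : Continuous fun t : ℝ => (t, trunc n p r z))).intervalIntegrable _ _

theorem dHform_integral {r m : ℕ} {Φ : (Fin m → Fin n) → ℝ → Jet n p → ℝ}
    (hΦ : ∀ v, SmoothFamily r (Φ v)) (w : Fin (m + 1) → Fin n) (z : Jet n p) :
    dHform (fun v z => ∫ t in (0 : ℝ)..1, Φ v t z) w z =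
      ∫ t in (0 : ℝ)..1, dHform (fun v => Φ v t) w z := by
  simp only [dHform, Finset.sum_apply, Pi.smul_apply, (hΦ _).totalDeriv_integral, smul_eq_mul]
  rw [intervalIntegral.integral_finsetSum fun j _ =>
    (((hΦ _).continuous_totalDeriv _ z).const_mul _).intervalIntegrable _ _]
  simp only [intervalIntegral.integral_const_mul]

/-- Scaling of the fibre coordinates. -/
def fiberScale (t : ℝ) : Jet n p →ₗ[ℝ] Jet n p where
  toFun z := (z.1, t • z.2)
  map_add' z w := by rw [Prod.snd_add, smul_add]; rfl
  map_smul' a z := by rw [Prod.smul_snd, smul_comm]; rfl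

/-- Scaling of the base coordinates, on the zero section. -/
def baseScale (t : ℝ) : Jet n p →ₗ[ℝ] Jet n p where
  toFun z := (t • z.1, 0)
  map_add' z w := by ext <;> simp [mul_add]
  map_smul' a z := by ext <;> simp [mul_left_comm]

theorem SmoothOfOrder.comp_fiberScale {r : ℕ} {φ : Jet n p → ℝ} (hφ : SmoothOfOrder r φ) :
    SmoothFamily r (fun t z => φ (fiberScale t z)) := by
  obtain ⟨F, hF, rfl⟩ := hφ
  exact ⟨fun q => F (q.2.1, q.1 • q.2.2), hF.comp (by fun_prop), fun _ _ => rfl⟩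

theorem SmoothOfOrder.comp_baseScale {r : ℕ} {φ : Jet n p → ℝ} (hφ : SmoothOfOrder r φ) :
    SmoothFamily r (fun t z => φ (baseScale t z)) := by
  obtain ⟨F, hF, rfl⟩ := hφ
  exact ⟨fun q => F (q.1 • q.2.1, 0), hF.comp (by fun_prop), fun _ _ => rfl⟩

theorem smoothOfOrder_coord (i : Fin p) {q : ℕ} {L : Fin n → ℕ} (hL : ∀ μ, L μ ≤ q) :
    SmoothOfOrder q (fun z : Jet n p => z.2 i L) :=
  ⟨fun w => w.2 i fun μ => ⟨L μ, Nat.lt_succ_of_le (hL μ)⟩, by fun_prop, rfl⟩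

theorem smoothOfOrder_baseCoord (q : ℕ) (μ : Fin n) : SmoothOfOrder q (fun z : Jet n p => z.1 μ) :=
  ⟨fun w => w.1 μ, by fun_prop, rfl⟩

theorem FiniteOrderSmooth.hasLineDerivAt_comp {φ : Jet n p → ℝ} (hφ : FiniteOrderSmooth φ)
    (T : Jet n p →ₗ[ℝ] Jet n p) (z v : Jet n p) :
    HasLineDerivAt ℝ (fun z => φ (T z)) (lineDeriv ℝ φ (T z) (T v)) z v := by
  have h := hφ.hasLineDerivAt (T z) (T v)
  simpa only [HasLineDerivAt, map_add, map_smul] using h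

theorem fiberScale_totalVec (t : ℝ) (l : Fin n) (z : Jet n p) :
    fiberScale t (totalVec l z) = totalVec l (fiberScale t z) := rfl

theorem baseScale_totalVec (t : ℝ) (l : Fin n) (z : Jet n p) :
    baseScale t (totalVec l z) = t • totalVec l (baseScale t z) := by
  ext <;> simp [baseScale, totalVec]

theorem fiberScale_zero (z : Jet n p) : fiberScale 0 z = baseScale 1 z := by
  ext <;> simp [fiberScale, baseScale]

theorem fiberScale_one (z : Jet n p) : fiberScale 1 z = z := by
  ext <;> simp [fiberScale]

/-- The multi-indices with entries at most `q`. -/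
def multiBox (n q : ℕ) : Finset (Fin n → ℕ) := Fintype.piFinset fun _ => Finset.range (q + 1)

theorem mem_multiBox {q : ℕ} {L : Fin n → ℕ} : L ∈ multiBox n q ↔ ∀ μ, L μ ≤ q := by
  simp [multiBox]

theorem sum_multiBox {q : ℕ} (g : (Fin n → ℕ) → ℝ) :
    ∑ L ∈ multiBox n q, g L = ∑ L : Fin n → Fin (q + 1), g fun μ => (L μ : ℕ) := by
  symm
  refine Finset.sum_bij (fun L _ μ => (L μ : ℕ)) (fun L _ => mem_multiBox.2 fun μ => ?_)
    (fun L _ L' _ h => ?_) (fun L hL => ?_) (fun _ _ => rfl)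
  · exact Nat.lt_succ_iff.1 (L μ).2
  · exact funext fun μ => Fin.ext (congrFun h μ)
  · exact ⟨fun μ => ⟨L μ, Nat.lt_succ_of_le (mem_multiBox.1 hL μ)⟩, Finset.mem_univ _, rfl⟩

theorem lineDeriv_fiber_eq_sum {q : ℕ} {φ : Jet n p → ℝ} (hφ : SmoothOfOrder q φ) (z : Jet n p)
    (y : Fin p → (Fin n → ℕ) → ℝ) :
    lineDeriv ℝ φ z (0, y) =
      ∑ i, ∑ L ∈ multiBox n q, y i L * lineDeriv ℝ φ z (fiberVec i L) := by
  obtain ⟨F, hF, rfl⟩ := hφ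
  simp only [lineDeriv_comp_trunc hF, sum_multiBox, trunc_fiberVec]
  rw [trunc_base_add_sum (trunc n p q (0, y))]
  have h0 : (((trunc n p q (0, y)).1, 0) : JTrunc n p q) = 0 := rfl
  rw [h0, zero_add]
  simp only [map_sum, map_smul, smul_eq_mul]
  rfl

/-- Evaluation of a vertical form on the Euler field along the fibre scaling. -/
def vertEval (q : ℕ) (t : ℝ) : VertForm n p →ₗ[ℝ] (Jet n p → ℝ) where
  toFun f z := ∑ i, ∑ L ∈ multiBox n q, z.2 i L * (f i L).1 (fiberScale t z)
  map_add' f g := by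
    funext z
    simp [mul_add, Finset.sum_add_distrib]
  map_smul' a f := by
    funext z
    simp [Finset.mul_sum, mul_left_comm]

theorem vertEval_apply (q : ℕ) (t : ℝ) (f : VertForm n p) (z : Jet n p) :
    vertEval q t f z = ∑ i, ∑ L ∈ multiBox n q, z.2 i L * (f i L).1 (fiberScale t z) := rfl

theorem smoothFamily_vertEval {q : ℕ} {f : VertForm n p} (hf : ∀ i L, SmoothOfOrder q (f i L).1) :
    SmoothFamily q (fun t => vertEval q t f) :=
  SmoothFamily.sum Finset.univ fun i _ => SmoothFamily.sum (multiBox n q) fun L hL =>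
    (smoothOfOrder_coord i (mem_multiBox.1 hL)).smoothFamily.mul (hf i L).comp_fiberScale

theorem sum_multiBox_shift {q : ℕ} (l : Fin n) {g : (Fin n → ℕ) → ℝ}
    (hg : ∀ L, (¬ ∀ μ, L μ ≤ q) → g L = 0) (y : (Fin n → ℕ) → ℝ) :
    ∑ L ∈ multiBox n (q + 1), y (L + Pi.single l 1) * g L =
      ∑ L ∈ multiBox n (q + 1), y L * if L l = 0 then 0 else g (L - Pi.single l 1) := by
  refine Finset.sum_bij_ne_zero (fun L _ _ => L + Pi.single l 1) (fun L _ h => ?_)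
    (fun L _ _ L' _ _ h => add_right_cancel h) (fun L hL h => ?_) (fun L _ _ => ?_)
  · have hL : ∀ μ, L μ ≤ q := by
      by_contra hL
      exact h (by rw [hg L hL, mul_zero])
    refine mem_multiBox.2 fun μ => ?_
    have := hL μ
    by_cases hμ : μ = l
    · subst hμ
      simp [this]
    · simp [hμ]
      omega
  · have h0 : L l ≠ 0 := fun h0 => h (by rw [if_pos h0, mul_zero])
    have h1 : L - Pi.single l 1 + Pi.single l 1 = L := by
      refine tsub_add_cancel_of_le fun ν => ?_
      by_cases hν : ν = l
      · subst hν
        simp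
        omega
      · simp [hν]
    refine ⟨L - Pi.single l 1, mem_multiBox.2 fun μ => ?_, ?_, h1⟩
    · exact le_trans (Nat.sub_le _ _) (mem_multiBox.1 hL μ)
    · rw [h1]
      rwa [if_neg h0] at h
  · simp

theorem totalDeriv_vertEval {q : ℕ} (t : ℝ) (l : Fin n) {f : VertForm n p}
    (hf : f ∈ vertOrderLE n p q) :
    totalDeriv l (vertEval (q + 1) t f) = vertEval (q + 1) t (vertTotal l f) := by
  have hfs : ∀ i L, SmoothOfOrder (q + 1) (f i L).1 := fun i L => (hf i L).1.mono q.le_succ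
  rw [totalDeriv_eq_lineDeriv l ⟨_, (smoothFamily_vertEval hfs).smoothOfOrder t⟩]
  funext z
  have hterm (i : Fin p) (L : Fin n → ℕ) : HasLineDerivAt ℝ
      (fun z : Jet n p => z.2 i L * (f i L).1 (fiberScale t z))
      (z.2 i (L + Pi.single l 1) * (f i L).1 (fiberScale t z) +
        z.2 i L * totalDeriv l (f i L).1 (fiberScale t z)) z (totalVec l z) := by
    have h1 : HasDerivAt (fun s : ℝ => (z + s • totalVec l z).2 i L)
        (z.2 i (L + Pi.single l 1)) 0 := by
      have := ((hasDerivAt_id (0 : ℝ)).mul_const (z.2 i (L + Pi.single l 1))).const_add (z.2 i L)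
      simpa [totalVec] using this
    have h2 := (f i L).2.hasLineDerivAt_comp (fiberScale t) z (totalVec l z)
    rw [fiberScale_totalVec] at h2
    have h3 := HasDerivAt.fun_mul h1 h2
    rw [totalDeriv_eq_lineDeriv l (f i L).2]
    simpa [HasLineDerivAt] using h3
  have hsum : HasLineDerivAt ℝ (vertEval (q + 1) t f) (∑ i, ∑ L ∈ multiBox n (q + 1),
      (z.2 i (L + Pi.single l 1) * (f i L).1 (fiberScale t z) +
        z.2 i L * totalDeriv l (f i L).1 (fiberScale t z))) z (totalVec l z) :=
    HasDerivAt.fun_sum (u := Finset.univ) fun i _ =>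
      HasDerivAt.fun_sum (u := multiBox n (q + 1)) fun L _ => hterm i L
  rw [hsum.lineDeriv, vertEval_apply]
  refine Finset.sum_congr rfl fun i _ => ?_
  have hshift := sum_multiBox_shift l (q := q) (g := fun L => (f i L).1 (fiberScale t z))
    (fun L hL => by rw [(hf i L).2 hL]; rfl) (z.2 i)
  rw [Finset.sum_add_distrib, hshift, add_comm, ← Finset.sum_add_distrib]
  refine Finset.sum_congr rfl fun L _ => ?_
  rw [vertTotal_apply, ← mul_add]
  congr 1
  split_ifs <;> rfl

theorem hasDerivAt_fiberScale {q : ℕ} {φ : finiteOrder n p} (hφ : SmoothOfOrder q φ.1)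
    (z : Jet n p) (t : ℝ) :
    HasDerivAt (fun t => φ.1 (fiberScale t z)) (vertEval q t (vertDiff φ) z) t := by
  have h := φ.2.hasLineDerivAt (fiberScale t z) (0, z.2)
  rw [lineDeriv_fiber_eq_sum hφ, HasLineDerivAt, ← sub_self t] at h
  have hs (s : ℝ) : fiberScale t z + (s - t) • ((0, z.2) : Jet n p) = fiberScale s z := by
    refine Prod.ext (by simp [fiberScale]) ?_
    change t • z.2 + (s - t) • z.2 = s • z.2
    rw [← add_smul, add_sub_cancel]
  have h3 := h.comp_sub_const t t
  simp only [hs] at h3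
  exact h3

theorem hasDerivAt_baseScale (φ : finiteOrder n p) (z : Jet n p) (t : ℝ) :
    HasDerivAt (fun t => φ.1 (baseScale t z))
      (∑ μ, z.1 μ * totalDeriv μ φ.1 (baseScale t z)) t := by
  have h := φ.2.hasLineDerivAt (baseScale t z) (z.1, 0)
  have h1 : ((z.1, 0) : Jet n p) = ∑ μ, z.1 μ • totalVec μ (baseScale t z) := by
    have h2 (μ : Fin n) : totalVec μ (baseScale t z) = baseVec μ := rfl
    refine Prod.ext ?_ ?_
    · funext l
      simp [h2, baseVec, Prod.fst_sum, Finset.sum_apply, Pi.single_apply]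
    · simp [h2, baseVec, Prod.snd_sum]
  rw [HasLineDerivAt, ← sub_self t] at h
  have h3 := h.comp_sub_const t t
  have hs (s : ℝ) : baseScale t z + (s - t) • ((z.1, 0) : Jet n p) = baseScale s z := by
    refine Prod.ext ?_ (by simp [baseScale])
    change t • z.1 + (s - t) • z.1 = s • z.1
    rw [← add_smul, add_sub_cancel]
  simp only [hs] at h3
  rw [h1, lineDeriv_sum_smul φ.2] at h3
  simpa only [totalDeriv_eq_lineDeriv _ φ.2] using h3

theorem dHform_vertEval {q m : ℕ} (t : ℝ) {f : (Fin m → Fin n) → VertForm n p}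
    (hf : ∀ v, f v ∈ vertOrderLE n p q) (w : Fin (m + 1) → Fin n) :
    dHform (fun v => vertEval (q + 1) t (f v)) w = vertEval (q + 1) t (koszulD vertTotal f w) := by
  simp only [dHform, koszulD, totalDeriv_vertEval t _ (hf _), map_sum, map_smul]

/-- The fibre homotopy: a closed form is exact up to its restriction to the zero section. -/
theorem exists_koszulD_eq_sub_fiberScale_zero {m : ℕ} (hmn : m + 1 < n) (r : ℕ)
    {c : (Fin (m + 1) → Fin n) → finiteOrder n p} (hr : ∀ v, SmoothOfOrder r (c v).1)
    (hc : IsAntisym c) (hd : koszulD totalDerivLin c = 0) :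
    ∃ b : (Fin m → Fin n) → finiteOrder n p, (∀ v, SmoothOfOrder (r + (n * r + 1) + 1) (b v).1) ∧
      IsAntisym b ∧
        ∀ w z, (koszulD totalDerivLin b w).1 z = (c w).1 z - (c w).1 (baseScale 1 z) := by
  obtain ⟨f, hf, hfa, hfd⟩ := exists_koszulD_vertTotal_eq hmn r hr hc hd
  set q := r + (n * r + 1) with hq
  have hfam (v : Fin m → Fin n) : SmoothFamily (q + 1) fun t => vertEval (q + 1) t (f v) :=
    smoothFamily_vertEval fun i L => (hf v i L).1.mono q.le_succ
  refine ⟨fun v => ⟨_, _, (hfam v).integral⟩, fun v => (hfam v).integral, fun v σ => ?_,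
    fun w z => ?_⟩
  · refine Subtype.ext (funext fun z => ?_)
    change ∫ t in (0 : ℝ)..1, vertEval (q + 1) t (f (v ∘ σ)) z =
      ((Equiv.Perm.sign σ : ℤ) : ℝ) * ∫ t in (0 : ℝ)..1, vertEval (q + 1) t (f v) z
    rw [← intervalIntegral.integral_const_mul]
    simp only [hfa v σ, map_smul, Pi.smul_apply, smul_eq_mul]
  · have hcw : SmoothOfOrder (q + 1) (c w).1 := (hr w).mono (by omega)
    rw [coe_koszulD_totalDerivLin]
    refine (dHform_integral hfam w z).trans ?_
    simp only [dHform_vertEval _ hf, hfd]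
    rw [intervalIntegral.integral_eq_sub_of_hasDerivAt
      (fun t _ => hasDerivAt_fiberScale hcw z t), fiberScale_zero, fiberScale_one]
    refine ((smoothFamily_vertEval fun i L => ?_).continuous_apply z).intervalIntegrable _ _
    exact (vertDiff_mem hcw i L).1

/-- Multiplication by a base coordinate. -/
def coordMul (μ : Fin n) : finiteOrder n p →ₗ[ℝ] finiteOrder n p where
  toFun φ := ⟨fun z => z.1 μ * φ.1 z,
    φ.2.elim fun r hr => ⟨r, (smoothOfOrder_baseCoord r μ).mul hr⟩⟩
  map_add' _ _ := Subtype.ext (funext fun _ => mul_add _ _ _)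
  map_smul' _ _ := Subtype.ext (funext fun _ => mul_left_comm _ _ _)

theorem coe_coordMul (μ : Fin n) (φ : finiteOrder n p) :
    (coordMul μ φ : Jet n p → ℝ) = fun z => z.1 μ * φ.1 z := rfl

theorem coordMul_totalDerivLin (μ l : Fin n) (φ : finiteOrder n p) :
    coordMul μ (totalDerivLin l φ) =
      totalDerivLin l (coordMul μ φ) + if μ = l then (-1 : ℝ) • φ else 0 := by
  refine Subtype.ext (funext fun z => ?_)
  have h1 : HasDerivAt (fun s : ℝ => (z + s • totalVec l z).1 μ) (if μ = l then 1 else 0) 0 := by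
    have := ((hasDerivAt_id (0 : ℝ)).mul_const (if μ = l then (1 : ℝ) else 0)).const_add (z.1 μ)
    simpa [totalVec, Pi.single_apply] using this
  have h3 : HasLineDerivAt ℝ (coordMul μ φ).1 ((if μ = l then 1 else 0) * φ.1 z +
      z.1 μ * totalDeriv l φ.1 z) z (totalVec l z) := by
    have h := HasDerivAt.fun_mul h1 (φ.2.hasLineDerivAt z (totalVec l z))
    rw [totalDeriv_eq_lineDeriv l φ.2]
    simpa [HasLineDerivAt, coe_coordMul] using h
  have h4 : (totalDerivLin l (coordMul μ φ)).1 z = (if μ = l then 1 else 0) * φ.1 z +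
      z.1 μ * totalDeriv l φ.1 z := by
    rw [coe_totalDerivLin, totalDeriv_eq_lineDeriv l (coordMul μ φ).2]
    exact h3.lineDeriv
  change z.1 μ * totalDeriv l φ.1 z = (totalDerivLin l (coordMul μ φ)).1 z + _
  rw [h4]
  split_ifs
  · change _ = _ + (-1 : ℝ) * φ.1 z
    ring
  · change _ = _ + (0 : ℝ)
    ring

theorem SmoothOfOrder.koszulH_coordMul {r m : ℕ} {c : (Fin (m + 1) → Fin n) → finiteOrder n p}
    (hr : ∀ v, SmoothOfOrder r (c v).1) (v : Fin m → Fin n) :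
    SmoothOfOrder r (koszulH coordMul c v).1 := by
  have h := (SmoothFamily.sum Finset.univ fun μ _ =>
    ((smoothOfOrder_baseCoord r μ).mul (hr (Fin.cons μ v))).smoothFamily).smoothOfOrder 0
  convert h using 1
  funext z
  simp [koszulH, coe_coordMul]

theorem totalDeriv_pow_mul_baseScale (k : ℕ) (t : ℝ) (l : Fin n) (φ : finiteOrder n p)
    (z : Jet n p) : totalDeriv l (fun z => t ^ k * φ.1 (baseScale t z)) z =
      t ^ (k + 1) * totalDeriv l φ.1 (baseScale t z) := by
  have hfo : FiniteOrderSmooth fun z => t ^ k * φ.1 (baseScale t z) :=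
    φ.2.elim fun r hr => ⟨r, (hr.comp_baseScale.smoothOfOrder t).smul (t ^ k)⟩
  rw [totalDeriv_eq_lineDeriv l hfo, totalDeriv_eq_lineDeriv l φ.2]
  have h := HasDerivAt.const_mul (t ^ k)
    (φ.2.hasLineDerivAt_comp (baseScale t) z (totalVec l z))
  rw [baseScale_totalVec] at h
  have h2 : lineDeriv ℝ φ.1 (baseScale t z) (t • totalVec l (baseScale t z)) =
      t * lineDeriv ℝ φ.1 (baseScale t z) (totalVec l (baseScale t z)) := lineDeriv_smul
  rw [h2, ← mul_assoc, ← pow_succ] at h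
  exact HasLineDerivAt.lineDeriv h

theorem smoothFamily_pow_mul_baseScale {r : ℕ} (k : ℕ) {φ : Jet n p → ℝ} (hφ : SmoothOfOrder r φ) :
    SmoothFamily r fun t z => t ^ k * φ (baseScale t z) :=
  (smoothFamily_of_contDiff r (contDiff_id.pow k)).mul hφ.comp_baseScale

/-- The base homotopy: the restriction of a closed form to the zero section is exact. -/
theorem exists_koszulD_eq_baseScale_one {m : ℕ} (r : ℕ)
    {c : (Fin (m + 1) → Fin n) → finiteOrder n p} (hr : ∀ v, SmoothOfOrder r (c v).1)
    (hc : IsAntisym c) (hd : koszulD totalDerivLin c = 0) :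
    ∃ b : (Fin m → Fin n) → finiteOrder n p, (∀ v, SmoothOfOrder r (b v).1) ∧
      IsAntisym b ∧ ∀ w z, (koszulD totalDerivLin b w).1 z = (c w).1 (baseScale 1 z) := by
  have hfam (v : Fin (m + 1) → Fin n) := smoothFamily_pow_mul_baseScale m (hr v)
  let g : (Fin (m + 1) → Fin n) → finiteOrder n p := fun v => ⟨_, r, (hfam v).integral⟩
  have hga : IsAntisym g := fun v σ => by
    refine Subtype.ext (funext fun z => ?_)
    change ∫ t in (0 : ℝ)..1, t ^ m * (c (v ∘ σ)).1 (baseScale t z) =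
      ((Equiv.Perm.sign σ : ℤ) : ℝ) * ∫ t in (0 : ℝ)..1, t ^ m * (c v).1 (baseScale t z)
    rw [← intervalIntegral.integral_const_mul]
    simp only [hc v σ, Submodule.coe_smul, Pi.smul_apply, smul_eq_mul, mul_left_comm]
  have hgd : koszulD totalDerivLin g = 0 := by
    funext w
    refine Subtype.ext (funext fun z => ?_)
    rw [coe_koszulD_totalDerivLin]
    refine (dHform_integral hfam w z).trans ?_
    have h0 (t : ℝ) : dHform (fun v z => t ^ m * (c v).1 (baseScale t z)) w z = 0 := by
      have h1 : dHform (fun v => (c v : Jet n p → ℝ)) w (baseScale t z) = 0 := by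
        rw [← coe_koszulD_totalDerivLin, hd]
        rfl
      have h2 : dHform (fun v z => t ^ m * (c v).1 (baseScale t z)) w z =
          t ^ (m + 1) * dHform (fun v => (c v : Jet n p → ℝ)) w (baseScale t z) := by
        simp only [dHform, Finset.sum_apply, Pi.smul_apply, totalDeriv_pow_mul_baseScale,
          smul_eq_mul, Finset.mul_sum, mul_left_comm]
      rw [h2, h1, mul_zero]
    simp only [h0, intervalIntegral.integral_zero]
    rfl
  refine ⟨koszulH coordMul g, SmoothOfOrder.koszulH_coordMul fun v => (hfam v).integral,
    hga.koszulH coordMul, fun w z => ?_⟩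
  have h := koszulD_koszulH_add totalDerivLin coordMul (-1) coordMul_totalDerivLin hga w
  have h0 : koszulH coordMul (koszulD totalDerivLin g) w = 0 := by
    simp [hgd, koszulH]
  rw [h0, add_zero] at h
  have hderiv (t : ℝ) : HasDerivAt (fun t => t ^ (m + 1) * (c w).1 (baseScale t z))
      ((∑ μ, z.1 μ * (t ^ (m + 1) * totalDeriv μ (c w).1 (baseScale t z))) +
        ((m : ℝ) + 1) * (t ^ m * (c w).1 (baseScale t z))) t := by
    have h1 : t ^ (m + 1) * ∑ μ, z.1 μ * totalDeriv μ (c w).1 (baseScale t z) =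
        ∑ μ, z.1 μ * (t ^ (m + 1) * totalDeriv μ (c w).1 (baseScale t z)) := by
      rw [Finset.mul_sum]
      exact Finset.sum_congr rfl fun μ _ => mul_left_comm _ _ _
    refine ((hasDerivAt_pow (m + 1) t).fun_mul (hasDerivAt_baseScale (c w) z t)).congr_deriv ?_
    rw [h1, Nat.add_sub_cancel]
    push_cast
    ring
  have hcont (μ : Fin n) :
      Continuous fun t => t ^ (m + 1) * totalDeriv μ (c w).1 (baseScale t z) := by
    simpa only [totalDeriv_pow_mul_baseScale] using (hfam w).continuous_totalDeriv μ z
  have hcont' := (hfam w).continuous_apply z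
  have hsum (μ : Fin n) : totalDeriv μ (g w).1 z =
      ∫ t in (0 : ℝ)..1, t ^ (m + 1) * totalDeriv μ (c w).1 (baseScale t z) := by
    refine ((hfam w).totalDeriv_integral μ z).trans ?_
    simp only [totalDeriv_pow_mul_baseScale]
  have hFTC := intervalIntegral.integral_eq_sub_of_hasDerivAt (a := 0) (b := 1)
    (fun t _ => hderiv t) (Continuous.intervalIntegrable (by fun_prop) _ _)
  rw [intervalIntegral.integral_add (Continuous.intervalIntegrable (by fun_prop) _ _)
    (Continuous.intervalIntegrable (by fun_prop) _ _), intervalIntegral.integral_finsetSum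
      fun μ _ => Continuous.intervalIntegrable (by fun_prop) _ _] at hFTC
  simp only [intervalIntegral.integral_const_mul, ← hsum] at hFTC
  have h5 : (koszulD totalDerivLin (koszulH coordMul g) w).1 z =
      (∑ μ, z.1 μ * totalDeriv μ (g w).1 z) + ((m : ℝ) + 1) * (g w).1 z := by
    rw [h]
    simp [coe_coordMul, coe_totalDerivLin]
    ring
  rw [h5]
  refine hFTC.trans ?_
  simp

end Jets

/-- **algebraic Poincaré lemma.**  For the trivial bundle
`ℝ^{n+p} → ℝ^n`, the horizontal differential `d_H = dx^λ ∧ d_λ` is exact on horizontal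
forms of degree `0 < m+1 < n` whose coefficients are smooth functions of finitely many jet
coordinates: every `d_H`-closed horizontal `(m+1)`-form `c` of jet order `≤ r` is
`d_H`-exact, `c = d_H b`, where the coefficients of `b` depend smoothly on finitely many
jet variables, of jet order bounded by a bound `r'` depending only on the jet order `r`
of `c` (the bound produced by the homotopy operator). -/
theorem stmt_11 {n p m : ℕ} (hmn : m + 1 < n) (r : ℕ) :
    ∃ r' : ℕ, ∀ c : (Fin (m + 1) → Fin n) → Jet n p → ℝ,
      (∀ v, SmoothOfOrder r (c v)) →
      Antisym c →
      dHform c = 0 →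
      ∃ b : (Fin m → Fin n) → Jet n p → ℝ,
        (∀ v, SmoothOfOrder r' (b v)) ∧ Antisym b ∧ dHform b = c := by
  refine ⟨r + (n * r + 1) + 1, fun c hr hc hd => ?_⟩
  let c' : (Fin (m + 1) → Fin n) → finiteOrder n p := fun v => ⟨c v, r, hr v⟩
  have hc' : IsAntisym c' := fun v σ => Subtype.ext (hc v σ)
  have hd' : koszulD totalDerivLin c' = 0 := funext fun w => Subtype.ext <| by
    rw [coe_koszulD_totalDerivLin]
    exact congrFun hd w
  obtain ⟨b₁, hr₁, ha₁, h₁⟩ := exists_koszulD_eq_sub_fiberScale_zero hmn r hr hc' hd'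
  obtain ⟨b₀, hr₀, ha₀, h₀⟩ := exists_koszulD_eq_baseScale_one r hr hc' hd'
  have ha : IsAntisym fun v => (1 : ℝ) • b₁ v + (1 : ℝ) • b₀ v := ha₁.add_smul ha₀ 1 1
  refine ⟨fun v => ((1 : ℝ) • b₁ v + (1 : ℝ) • b₀ v : finiteOrder n p), fun v => ?_,
    fun v σ => congrArg Subtype.val (ha v σ), ?_⟩
  · exact ((hr₁ v).smul 1).add (((hr₀ v).mono (by omega)).smul 1)
  · funext w z
    rw [← coe_koszulD_totalDerivLin, koszulD_add_smul]
    change (1 : ℝ) * (koszulD totalDerivLin b₁ w).1 z + 1 * (koszulD totalDerivLin b₀ w).1 z = c w z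
    rw [h₁, h₀, one_mul, one_mul, sub_add_cancel]

end
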